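/- arXiv:2007.02544 — 4 statements merged into one kernel-verified Lean document; each statement's English description precedes it below -/
import Mathlib

section
/- Let V be a complex vector space equipped with a sesquilinear Hermitian form ⟨·,·⟩ (conjugate-linear in the first argument, with ⟨y,x⟩ the complex conjugate of ⟨x,y⟩), not assumed positive definite, and let γ : V → V be a complex-linear endomorphism with γ∘γ = −id and ⟨γx, y⟩ = ⟨x, γy⟩ for all x,y ∈ V. For ε ∈ {+1, −1} define π_ε := (1/2)·(id − ε·i·γ). Then π_ε∘π_ε = π_ε, and ⟨γ(π_ε ψ), π_ε ψ⟩ = 0 for every ψ ∈ V. -/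
/-- admissibility of the Lorentzian MIT bag boundary conditions:
`π_ε = (1/2)(id − εiγ)` is a projection and `⟨γ(π_εψ), π_εψ⟩ = 0`. -/
theorem stmt_6 (V : Type*) [AddCommGroup V] [Module ℂ V]
    (h : V →ₗ⋆[ℂ] V →ₗ[ℂ] ℂ)
    (hherm : ∀ x y : V, h y x = (starRingEnd ℂ) (h x y))
    (γ : V →ₗ[ℂ] V)
    (hγ2 : γ ∘ₗ γ = -LinearMap.id)
    (hγh : ∀ x y : V, h (γ x) y = h x (γ y))
    (ε : ℝ) (hε : ε = 1 ∨ ε = -1)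
    (π : V →ₗ[ℂ] V)
    (hπ : π = (1 / 2 : ℂ) • (LinearMap.id - ((ε : ℂ) * Complex.I) • γ)) :
    π ∘ₗ π = π ∧ ∀ ψ : V, h (γ (π ψ)) (π ψ) = 0 := by
  have hε2 : ((ε : ℂ) * Complex.I) * ((ε : ℂ) * Complex.I) = -1 := by
    rcases hε with rfl | rfl <;> simp
  have hγγ (x : V) : γ (γ x) = -x := by simpa using LinearMap.congr_fun hγ2 x
  have hπ_apply (x : V) : π x = (1 / 2 : ℂ) • (x - ((ε : ℂ) * Complex.I) • γ x) := by
    simp [hπ]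
  have hγπ (x : V) : γ (π x) = ((ε : ℂ) * Complex.I) • π x := by
    rw [hπ_apply, map_smul, map_sub, map_smul, hγγ, smul_comm ((ε : ℂ) * Complex.I) (1 / 2 : ℂ),
      smul_sub ((ε : ℂ) * Complex.I), smul_smul ((ε : ℂ) * Complex.I), hε2]
    module
  refine ⟨LinearMap.ext fun x => ?_, fun ψ => ?_⟩
  · rw [LinearMap.comp_apply, hπ_apply (π x), hγπ, smul_smul, hε2]
    module
  · have key := hγh (π ψ) (π ψ)
    rw [hγπ, LinearMap.map_smulₛₗ, LinearMap.smul_apply, map_smul] at key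
    rw [hγπ, LinearMap.map_smulₛₗ, LinearMap.smul_apply]
    simp only [map_mul, Complex.conj_ofReal, Complex.conj_I, smul_eq_mul] at key ⊢
    linear_combination (1 / 2 : ℂ) * key
end

section
/- Let V be a complex vector space equipped with a sesquilinear Hermitian form ⟨·,·⟩ (conjugate-linear in the first argument, with ⟨y,x⟩ the complex conjugate of ⟨x,y⟩), not assumed positive definite. Let γ : V → V be a complex-linear endomorphism with γ∘γ = −id and ⟨γx, y⟩ = ⟨x, γy⟩ for all x,y. Let G : V → V be an additive, conjugate-homogeneous map (G(c•x) = (conj c)•G(x)) with G∘G = id, G∘γ = −γ∘G, and such that Re⟨Gx, x⟩ = 0 for every x ∈ V. For ε ∈ {+1, −1} define the real-linear map π_ε := (1/2)·(id − ε·γ∘G). Then π_ε∘π_ε = π_ε, and ⟨γ(π_ε ψ), π_ε ψ⟩ = 0 for every ψ ∈ V. -/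
/-- admissibility of the Lorentzian chirality boundary conditions:
with a chirality operator `G` (conjugate-linear, involutive, anti-commuting with `γ`,
with `Re⟨Gx,x⟩ = 0`), the real-linear map `π_ε = (1/2)(id − εγ∘G)` is a projection
and `⟨γ(π_εψ), π_εψ⟩ = 0`. -/
theorem stmt_7 (V : Type*) [AddCommGroup V] [Module ℂ V]
    (h : V →ₗ⋆[ℂ] V →ₗ[ℂ] ℂ)
    (hherm : ∀ x y : V, h y x = (starRingEnd ℂ) (h x y))
    (γ : V →ₗ[ℂ] V)
    (hγ2 : γ ∘ₗ γ = -LinearMap.id)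
    (hγh : ∀ x y : V, h (γ x) y = h x (γ y))
    (G : V →ₗ⋆[ℂ] V)
    (hG2 : ∀ x : V, G (G x) = x)
    (hGγ : ∀ x : V, G (γ x) = -γ (G x))
    (hGim : ∀ x : V, (h (G x) x).re = 0)
    (ε : ℝ) (hε : ε = 1 ∨ ε = -1)
    (π : V → V)
    (hπ : ∀ x : V, π x = (1 / 2 : ℂ) • (x - (ε : ℂ) • γ (G x))) :
    (∀ x : V, π (π x) = π x) ∧ ∀ ψ : V, h (γ (π ψ)) (π ψ) = 0 := by
  have hγγ : ∀ x, γ (γ x) = -x := fun x => by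
    simpa using LinearMap.congr_fun hγ2 x
  have hεε : (ε : ℂ) * ε = 1 := by rcases hε with rfl | rfl <;> norm_num
  have hγG : ∀ x, γ (π x) = (ε : ℂ) • G (π x) := fun x => by
    have h1 : γ (π x) = (1 / 2 : ℂ) • (γ x + (ε : ℂ) • G x) := by
      simp [hπ, hγγ]
    have h2 : G (π x) = (1 / 2 : ℂ) • (G x + (ε : ℂ) • γ x) := by
      have hhalf : (starRingEnd ℂ) (1 / 2) = 1 / 2 := by simp [Complex.conj_ofNat]
      rw [hπ, map_smulₛₗ, hhalf, map_sub, map_smulₛₗ, Complex.conj_ofReal, hGγ, hG2, smul_neg,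
        sub_neg_eq_add]
    rw [h1, h2, smul_comm, smul_add (ε : ℂ), smul_smul, hεε, one_smul, add_comm]
  refine ⟨fun x => ?_, fun ψ => ?_⟩
  · rw [hπ (π x), ← map_smul, ← hγG, hγγ]
    module
  · have him : (h (γ (π ψ)) (π ψ)).im = 0 := by
      rw [← Complex.conj_eq_iff_im, ← hherm, ← hγh]
    have hre : (h (γ (π ψ)) (π ψ)).re = 0 := by
      rw [hγG, map_smulₛₗ, Complex.conj_ofReal, LinearMap.smul_apply, smul_eq_mul,
        Complex.re_ofReal_mul, hGim, mul_zero]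
    exact Complex.ext hre him
end

section
/- Let V be a complex vector space equipped with a sesquilinear Hermitian form ⟨·,·⟩ (conjugate-linear in the first argument, with ⟨y,x⟩ the complex conjugate of ⟨x,y⟩), not assumed positive definite. Let β > 0 be real and let γₙ, γ₀, G : V → V be complex-linear endomorphisms, each Hermitian with respect to the form (⟨Ax,y⟩ = ⟨x,Ay⟩), satisfying γₙ∘γₙ = −id, γ₀∘γ₀ = β²·id, γₙ∘γ₀ = −γ₀∘γₙ, G∘G = id, G∘γ₀ = γ₀∘G, and G∘γₙ = −γₙ∘G. Define π := (1/2)·(id + (i/β)·γₙ∘γ₀∘G). Then π∘π = π, and ⟨γₙ(πψ), πψ⟩ = 0 for every ψ ∈ V. -/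
/-- admissibility of the Riemannian chirality boundary conditions:
`π = (1/2)(id + (i/β)γₙγ₀G)` is a projection and `⟨γₙ(πψ), πψ⟩ = 0`. -/
theorem stmt_8 (V : Type*) [AddCommGroup V] [Module ℂ V]
    (h : V →ₗ⋆[ℂ] V →ₗ[ℂ] ℂ)
    (hherm : ∀ x y : V, h y x = (starRingEnd ℂ) (h x y))
    (β : ℝ) (hβ : 0 < β)
    (γn γ0 G : V →ₗ[ℂ] V)
    (hγnh : ∀ x y : V, h (γn x) y = h x (γn y))
    (hγ0h : ∀ x y : V, h (γ0 x) y = h x (γ0 y))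
    (hGh : ∀ x y : V, h (G x) y = h x (G y))
    (hγn2 : γn ∘ₗ γn = -LinearMap.id)
    (hγ02 : γ0 ∘ₗ γ0 = ((β : ℂ) ^ 2) • LinearMap.id)
    (hanti : γn ∘ₗ γ0 = -(γ0 ∘ₗ γn))
    (hG2 : G ∘ₗ G = LinearMap.id)
    (hGγ0 : G ∘ₗ γ0 = γ0 ∘ₗ G)
    (hGγn : G ∘ₗ γn = -(γn ∘ₗ G))
    (π : V →ₗ[ℂ] V)
    (hπ : π = (1 / 2 : ℂ) • (LinearMap.id + (Complex.I / (β : ℂ)) • (γn ∘ₗ γ0 ∘ₗ G))) :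
    π ∘ₗ π = π ∧ ∀ ψ : V, h (γn (π ψ)) (π ψ) = 0 := by
  have en (x : V) : γn (γn x) = -x := by simpa using LinearMap.congr_fun hγn2 x
  have e0 (x : V) : γ0 (γ0 x) = ((β : ℂ) ^ 2) • x := by simpa using LinearMap.congr_fun hγ02 x
  have en0 (x : V) : γn (γ0 x) = -γ0 (γn x) := by simpa using LinearMap.congr_fun hanti x
  have eG (x : V) : G (G x) = x := by simpa using LinearMap.congr_fun hG2 x
  have eG0 (x : V) : G (γ0 x) = γ0 (G x) := by simpa using LinearMap.congr_fun hGγ0 x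
  have eGn (x : V) : G (γn x) = -γn (G x) := by simpa using LinearMap.congr_fun hGγn x
  have hβ' : (β : ℂ) ≠ 0 := by exact_mod_cast hβ.ne'
  -- `P` is an involution, commutes with `γn`, and is skew-adjoint for the form.
  obtain ⟨P, hP⟩ : ∃ P : V →ₗ[ℂ] V, P = (Complex.I / (β : ℂ)) • (γn ∘ₗ γ0 ∘ₗ G) := ⟨_, rfl⟩
  have hPx (x : V) : P x = (Complex.I / (β : ℂ)) • γn (γ0 (G x)) := by simp [hP]
  have hPP (x : V) : P (P x) = x := by
    have hsq : (Complex.I / (β : ℂ)) * ((Complex.I / (β : ℂ)) * (β : ℂ) ^ 2) = -1 := by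
      field_simp
      simp
    simp only [hPx, map_smul, eGn, eG0, eG, map_neg, en0, en, e0, smul_smul, neg_neg, smul_neg]
    rw [hsq]
    simp
  have hPn (x : V) : P (γn x) = γn (P x) := by
    simp only [hPx, map_smul, eGn, map_neg, en0, en, neg_neg, smul_neg]
  have hPskew (x y : V) : h (P x) y = -h x (P y) := by
    simp only [hPx, LinearMap.map_smulₛₗ, LinearMap.smul_apply, LinearMap.neg_apply, hγnh, hγ0h, hGh, map_smul,
      eG0, eGn, en0, map_neg, neg_neg, map_div₀, Complex.conj_I, Complex.conj_ofReal, smul_eq_mul]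
    ring
  have hπx (x : V) : π x = (1 / 2 : ℂ) • (x + P x) := by rw [hπ, ← hP]; simp
  have hPπ (x : V) : P (π x) = π x := by
    simp only [hπx, map_smul, map_add, hPP, add_comm]
  refine ⟨?_, fun ψ => ?_⟩
  · ext x
    rw [LinearMap.comp_apply, hπx (π x), hPπ, ← two_smul ℂ (π x), smul_smul]
    norm_num
  · have hskew := hPskew (γn (π ψ)) (π ψ)
    rw [hPn, hPπ] at hskew
    exact self_eq_neg.mp hskew
end

section
/- Let V be a complex vector space equipped with a sesquilinear Hermitian form ⟨·,·⟩ (conjugate-linear in the first argument, with ⟨y,x⟩ the complex conjugate of ⟨x,y⟩), not assumed positive definite. Let β > 0 be real and let γₙ, γ₀ : V → V be complex-linear endomorphisms, each Hermitian with respect to the form, satisfying γₙ∘γₙ = −id, γ₀∘γ₀ = β²·id, and γₙ∘γ₀ = −γ₀∘γₙ. Assume moreover that ⟨γ₀x, x⟩ is real and nonnegative for every x ∈ V. Define π₋ := (1/2)·(id − (1/β)·γₙ∘γ₀) and π₊ := (1/2)·(id + (1/β)·γₙ∘γ₀). Then π₋∘π₋ = π₋ and π₊∘π₊ = π₊, and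 for every ψ ∈ V one has ⟨γₙ(π₋ψ), π₋ψ⟩ = (1/β)·⟨γ₀(π₋ψ), π₋ψ⟩ ≥ 0 while ⟨γₙ(π₊ψ), π₊ψ⟩ = −(1/β)·⟨γ₀(π₊ψ), π₊ψ⟩ ≤ 0. -/
section CliffordProjection

variable {K V : Type*} [Field K] [AddCommGroup V] [Module K V] {γn γ0 : V →ₗ[K] V} {b c : K}

/-- Since `c • (γn ∘ γ0)` is an involution when `c ^ 2 * b ^ 2 = 1`, half of `id - c • (γn ∘ γ0)`
is a projection. -/
lemma half_id_sub_smul_comp_idempotent [NeZero (2 : K)]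
    (hn : γn ∘ₗ γn = -LinearMap.id) (h0 : γ0 ∘ₗ γ0 = (b ^ 2) • LinearMap.id)
    (hanti : γn ∘ₗ γ0 = -(γ0 ∘ₗ γn)) (hc : c ^ 2 * b ^ 2 = 1) :
    ((1 / 2 : K) • (LinearMap.id - c • (γn ∘ₗ γ0))) ∘ₗ
        ((1 / 2 : K) • (LinearMap.id - c • (γn ∘ₗ γ0))) =
      (1 / 2 : K) • (LinearMap.id - c • (γn ∘ₗ γ0)) := by
  have h2 : (2 : K) ≠ 0 := two_ne_zero
  have hn' (x : V) : γn (γn x) = -x := by simpa using LinearMap.congr_fun hn x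
  have h0' (x : V) : γ0 (γ0 x) = b ^ 2 • x := by simpa using LinearMap.congr_fun h0 x
  have ha (x : V) : γ0 (γn x) = -γn (γ0 x) := by
    simpa using (congrArg Neg.neg (LinearMap.congr_fun hanti x)).symm
  ext x
  simp only [LinearMap.comp_apply, LinearMap.smul_apply, LinearMap.sub_apply, LinearMap.id_apply,
    map_smul, map_sub, map_neg, ha, h0', hn']
  match_scalars
  · field_simp
    linear_combination hc
  · field_simp
    ring

/-- On the range of the projection `(id - c • (γn ∘ γ0)) / 2`, the endomorphisms `γn` and `c • γ0`
agree. -/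
lemma apply_half_id_sub_smul_comp
    (hn : γn ∘ₗ γn = -LinearMap.id) (h0 : γ0 ∘ₗ γ0 = (b ^ 2) • LinearMap.id)
    (hanti : γn ∘ₗ γ0 = -(γ0 ∘ₗ γn)) (hc : c ^ 2 * b ^ 2 = 1) (x : V) :
    γn (((1 / 2 : K) • (LinearMap.id - c • (γn ∘ₗ γ0)) : V →ₗ[K] V) x) =
      c • γ0 (((1 / 2 : K) • (LinearMap.id - c • (γn ∘ₗ γ0)) : V →ₗ[K] V) x) := by
  have hn' (x : V) : γn (γn x) = -x := by simpa using LinearMap.congr_fun hn x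
  have h0' (x : V) : γ0 (γ0 x) = b ^ 2 • x := by simpa using LinearMap.congr_fun h0 x
  have ha (x : V) : γ0 (γn x) = -γn (γ0 x) := by
    simpa using (congrArg Neg.neg (LinearMap.congr_fun hanti x)).symm
  simp only [LinearMap.comp_apply, LinearMap.smul_apply, LinearMap.sub_apply, LinearMap.id_apply,
    map_smul, map_sub, ha, h0', hn']
  match_scalars
  · linear_combination (-1 / 2 : K) * hc
  · ring

end CliffordProjection


/-- the Riemannian MIT bag projection `π₋ = (1/2)(id − (1/β)γₙγ₀)` is
admissible (the boundary form is nonnegative on its range), while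
`π₊ = (1/2)(id + (1/β)γₙγ₀)` is not (the form is nonpositive on its range). -/
theorem stmt_9 (V : Type*) [AddCommGroup V] [Module ℂ V]
    (h : V →ₗ⋆[ℂ] V →ₗ[ℂ] ℂ)
    (hherm : ∀ x y : V, h y x = (starRingEnd ℂ) (h x y))
    (β : ℝ) (hβ : 0 < β)
    (γn γ0 : V →ₗ[ℂ] V)
    (hγnh : ∀ x y : V, h (γn x) y = h x (γn y))
    (hγ0h : ∀ x y : V, h (γ0 x) y = h x (γ0 y))
    (hγn2 : γn ∘ₗ γn = -LinearMap.id)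
    (hγ02 : γ0 ∘ₗ γ0 = ((β : ℂ) ^ 2) • LinearMap.id)
    (hanti : γn ∘ₗ γ0 = -(γ0 ∘ₗ γn))
    (hγ0pos : ∀ x : V, (h (γ0 x) x).im = 0 ∧ 0 ≤ (h (γ0 x) x).re)
    (πm πp : V →ₗ[ℂ] V)
    (hπm : πm = (1 / 2 : ℂ) • (LinearMap.id - ((1 : ℂ) / (β : ℂ)) • (γn ∘ₗ γ0)))
    (hπp : πp = (1 / 2 : ℂ) • (LinearMap.id + ((1 : ℂ) / (β : ℂ)) • (γn ∘ₗ γ0))) :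
    (πm ∘ₗ πm = πm ∧ πp ∘ₗ πp = πp) ∧
    (∀ ψ : V,
      h (γn (πm ψ)) (πm ψ) = ((1 : ℂ) / (β : ℂ)) * h (γ0 (πm ψ)) (πm ψ) ∧
      (h (γn (πm ψ)) (πm ψ)).im = 0 ∧ 0 ≤ (h (γn (πm ψ)) (πm ψ)).re) ∧
    (∀ ψ : V,
      h (γn (πp ψ)) (πp ψ) = -(((1 : ℂ) / (β : ℂ)) * h (γ0 (πp ψ)) (πp ψ)) ∧
      (h (γn (πp ψ)) (πp ψ)).im = 0 ∧ (h (γn (πp ψ)) (πp ψ)).re ≤ 0) := by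
  have hβ' : (β : ℂ) ≠ 0 := by exact_mod_cast hβ.ne'
  have hc : ((1 : ℂ) / β) ^ 2 * (β : ℂ) ^ 2 = 1 := by field_simp
  have hc' : (-((1 : ℂ) / β)) ^ 2 * (β : ℂ) ^ 2 = 1 := by rw [neg_sq, hc]
  rw [← sub_neg_eq_add, ← neg_smul] at hπp
  have hcast : (1 : ℂ) / β = ((1 / β : ℝ) : ℂ) := by push_cast; rfl
  have hm (ψ : V) : h (γn (πm ψ)) (πm ψ) = (1 : ℂ) / β * h (γ0 (πm ψ)) (πm ψ) := by
    have key : γn (πm ψ) = ((1 : ℂ) / β) • γ0 (πm ψ) := by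
      rw [hπm]
      exact apply_half_id_sub_smul_comp hγn2 hγ02 hanti hc ψ
    rw [key]
    simp
  have hp (ψ : V) : h (γn (πp ψ)) (πp ψ) = -((1 : ℂ) / β * h (γ0 (πp ψ)) (πp ψ)) := by
    have key : γn (πp ψ) = (-((1 : ℂ) / β)) • γ0 (πp ψ) := by
      rw [hπp]
      exact apply_half_id_sub_smul_comp hγn2 hγ02 hanti hc' ψ
    rw [key]
    simp
  refine ⟨⟨?_, ?_⟩, fun ψ => ⟨hm ψ, ?_, ?_⟩, fun ψ => ⟨hp ψ, ?_, ?_⟩⟩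
  · rw [hπm]
    exact half_id_sub_smul_comp_idempotent hγn2 hγ02 hanti hc
  · rw [hπp]
    exact half_id_sub_smul_comp_idempotent hγn2 hγ02 hanti hc'
  · rw [hm, hcast, Complex.im_ofReal_mul, (hγ0pos _).1, mul_zero]
  · rw [hm, hcast, Complex.re_ofReal_mul]
    exact mul_nonneg (by positivity) (hγ0pos _).2
  · rw [hp, hcast, Complex.neg_im, Complex.im_ofReal_mul, (hγ0pos _).1, mul_zero, neg_zero]
  · rw [hp, hcast, Complex.neg_re, Complex.re_ofReal_mul, neg_nonpos]
    exact mul_nonneg (by positivity) (hγ0pos _).2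
end
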